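/- arXiv:2105.04685 — 2 statements merged into one kernel-verified Lean document; each statement's English description precedes it below -/
import Mathlib

section
/- Fix m ∈ ℕ and let (x_n)_{n∈ℕ} be a sequence of ℝ^m-valued random variables satisfying a large deviation principle with good rate function I. Let U be uniformly distributed on [0,1], independent of (x_n). If for every x ∈ ℝ^m the map c ↦ I(cx) is nondecreasing on [0,∞), then the sequence (U^{1/n} x_n)_{n∈ℕ} satisfies a large deviation principle with the same good rate function I. -/
open MeasureTheory ProbabilityTheory Filter Topology
open scoped ENNReal

noncomputable section

/-- `(1/n) log P_n(B)`, as an extended real number. -/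
def ldScale {X : Type*} [MeasurableSpace X] (P : ℕ → Measure X) (B : Set X) (n : ℕ) : EReal :=
  (((n : ℝ)⁻¹ : ℝ) : EReal) * ENNReal.log (P n B)

/-- The sequence of Borel measures `P n` satisfies the large deviation principle with
rate function `I : X → [0, ∞]`: `I` is nonnegative and, for every Borel set `B`,
`-inf_{x ∈ B°} I(x) ≤ liminf (1/n) log P_n(B)` and
`limsup (1/n) log P_n(B) ≤ -inf_{x ∈ B̄} I(x)`. -/
def IsLDP {X : Type*} [TopologicalSpace X] [MeasurableSpace X]
    (P : ℕ → Measure X) (I : X → EReal) : Prop :=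
  (∀ x, 0 ≤ I x) ∧
    ∀ B : Set X, MeasurableSet B →
      (-(⨅ x ∈ interior B, I x) ≤ Filter.liminf (ldScale P B) Filter.atTop) ∧
        (Filter.limsup (ldScale P B) Filter.atTop ≤ -(⨅ x ∈ closure B, I x))

/-- A good rate function: all sublevel sets are compact. -/
def IsGoodRate {X : Type*} [TopologicalSpace X] (I : X → EReal) : Prop :=
  ∀ c : ℝ, IsCompact {x | I x ≤ (c : EReal)}

/-- The points that some contraction `t ∈ [0, 1]` maps into a closed set form a closed set. -/
lemma isClosed_setOf_exists_smul_mem {E : Type*} [TopologicalSpace E] [SMul ℝ E]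
    [ContinuousSMul ℝ E] {F : Set E} (hF : IsClosed F) :
    IsClosed {y : E | ∃ t ∈ Set.Icc (0 : ℝ) 1, t • y ∈ F} := by
  have hcl : IsClosed {p : Set.Icc (0 : ℝ) 1 × E | (p.1 : ℝ) • p.2 ∈ F} :=
    hF.preimage (by fun_prop)
  have himage := isClosedMap_snd_of_compactSpace _ hcl
  convert himage using 1
  ext y
  simp

lemma ldScale_mono {X : Type*} [MeasurableSpace X] {P Q : ℕ → Measure X} {A B : Set X} {n : ℕ}
    (h : P n A ≤ Q n B) : ldScale P A n ≤ ldScale Q B n :=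
  mul_le_mul_of_nonneg_left (ENNReal.log_monotone h)
    (EReal.coe_nonneg.2 (by positivity))

/-- A constant factor does not affect the exponential rate. -/
lemma liminf_ldScale_le_of_mul_le {X : Type*} [MeasurableSpace X] {P Q : ℕ → Measure X}
    {A B : Set X} {c : ℝ≥0∞} (hc₀ : c ≠ 0) (hc : c ≠ ∞) (h : ∀ᶠ n in atTop, c * P n A ≤ Q n B) :
    liminf (ldScale P A) atTop ≤ liminf (ldScale Q B) atTop := by
  obtain ⟨r, hr⟩ : ∃ r : ℝ, ENNReal.log c = r :=
    ⟨(ENNReal.log c).toReal, (EReal.coe_toReal (by simpa using hc) (by simpa using hc₀)).symm⟩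
  have hlim : Tendsto (fun n : ℕ => (((n : ℝ)⁻¹ * r : ℝ) : EReal)) atTop (𝓝 0) := by
    have hreal : Tendsto (fun n : ℕ => (n : ℝ)⁻¹ * r) atTop (𝓝 0) := by
      simpa using (tendsto_inv_atTop_nhds_zero_nat (𝕜 := ℝ)).mul_const r
    exact (continuous_coe_real_ereal.tendsto 0).comp hreal
  have hadd : liminf (fun n : ℕ => (((n : ℝ)⁻¹ * r : ℝ) : EReal)) atTop
      + liminf (ldScale P A) atTop
      ≤ liminf ((fun n : ℕ => (((n : ℝ)⁻¹ * r : ℝ) : EReal)) + ldScale P A) atTop :=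
    EReal.le_liminf_add
  rw [hlim.liminf_eq, zero_add] at hadd
  refine hadd.trans (liminf_le_liminf ?_)
  filter_upwards [h] with n hn
  calc (((n : ℝ)⁻¹ * r : ℝ) : EReal) + ldScale P A n
      = (((n : ℝ)⁻¹ : ℝ) : EReal) * ENNReal.log (c * P n A) := by
        rw [ENNReal.log_mul_add, EReal.left_distrib_of_nonneg_of_ne_top
          (EReal.coe_nonneg.2 (by positivity)) (EReal.coe_ne_top _), hr, EReal.coe_mul, ldScale]
    _ ≤ ldScale Q B n := mul_le_mul_of_nonneg_left (ENNReal.log_monotone hn)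
        (EReal.coe_nonneg.2 (by positivity))

/-- **LDP is preserved by the independent scaling `U^{1/n}` when the rate function is
nondecreasing under scaling.**
Fix `m ∈ ℕ` and let `(x_n)` be a sequence of `ℝ^m`-valued random variables satisfying an
LDP with good rate function `I`.  Let `U` be uniformly distributed on `[0,1]`,
independent of `(x_n)`.  If for every `x ∈ ℝ^m` the map `c ↦ I(c x)` is nondecreasing on
`[0,∞)`, then the sequence `(U^{1/n} x_n)` satisfies an LDP with the same good rate
function `I`. -/
theorem ldp_of_uniform_scaling
    (m : ℕ) {Ω : Type*} [MeasurableSpace Ω] (Pr : Measure Ω) [IsProbabilityMeasure Pr]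
    (x : ℕ → Ω → EuclideanSpace ℝ (Fin m)) (hxmeas : ∀ n, Measurable (x n))
    (U : Ω → ℝ) (hUmeas : Measurable U)
    (hUlaw : Measure.map U Pr = volume.restrict (Set.Icc (0 : ℝ) 1))
    (hindep : IndepFun U (fun ω => fun n => x n ω) Pr)
    (I : EuclideanSpace ℝ (Fin m) → EReal)
    (hLDP : IsLDP (fun n => Measure.map (x n) Pr) I)
    (hgood : IsGoodRate I)
    (hmono : ∀ v : EuclideanSpace ℝ (Fin m), ∀ c₁ c₂ : ℝ, 0 ≤ c₁ → c₁ ≤ c₂ →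
      I (c₁ • v) ≤ I (c₂ • v)) :
    IsLDP (fun n => Measure.map (fun ω => (U ω ^ ((n : ℝ)⁻¹)) • x n ω) Pr) I := by
  have hsmul (n : ℕ) : Measurable fun ω => (U ω ^ ((n : ℝ)⁻¹)) • x n ω :=
    (hUmeas.pow_const _).smul (hxmeas n)
  have hUmem : ∀ᵐ ω ∂Pr, U ω ∈ Set.Icc (0 : ℝ) 1 := by
    refine ae_of_ae_map hUmeas.aemeasurable ?_
    rw [hUlaw]
    exact ae_restrict_mem measurableSet_Icc
  have hUhalf : Pr (U ⁻¹' Set.Icc (1 / 2) 1) = ENNReal.ofReal (1 / 2) := by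
    rw [← Measure.map_apply hUmeas measurableSet_Icc, hUlaw,
      Measure.restrict_apply measurableSet_Icc, Set.inter_eq_left.2 (Set.Icc_subset_Icc_left
        (by norm_num)), Real.volume_Icc]
    norm_num
  refine ⟨hLDP.1, fun B hB => ⟨?_, ?_⟩⟩
  · rw [EReal.neg_le]
    refine le_iInf₂ fun y hy => ?_
    rw [EReal.neg_le]
    have hnhds : ∀ᶠ p : ℝ × EuclideanSpace ℝ (Fin m) in 𝓝 1 ×ˢ 𝓝 y, p.1 • p.2 ∈ B := by
      rw [← nhds_prod_eq]
      refine ContinuousAt.eventually_mem (f := fun p : ℝ × EuclideanSpace ℝ (Fin m) => p.1 • p.2)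
        (by fun_prop) ?_
      simpa using mem_interior_iff_mem_nhds.1 hy
    obtain ⟨S, hS, T, hT, hST⟩ := eventually_prod_iff.1 hnhds
    obtain ⟨V, hVT, hVopen, hyV⟩ := mem_nhds_iff.1 hT
    obtain ⟨ε, hε, hεS⟩ := Metric.eventually_nhds_iff.1 hS
    have hroot : Tendsto (fun n : ℕ => (1 / 2 : ℝ) ^ ((n : ℝ)⁻¹)) atTop (𝓝 1) := by
      simpa [Function.comp_def] using ((Real.continuous_const_rpow (a := 1 / 2) (by norm_num)).tendsto 0).comp
        (tendsto_inv_atTop_nhds_zero_nat (𝕜 := ℝ))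
    calc -I y ≤ -(⨅ z ∈ interior V, I z) :=
          EReal.neg_le_neg_iff.2 (iInf₂_le y (by rwa [hVopen.interior_eq]))
      _ ≤ liminf (ldScale (fun n => Measure.map (x n) Pr) V) atTop :=
          (hLDP.2 V hVopen.measurableSet).1
      _ ≤ _ := by
          refine liminf_ldScale_le_of_mul_le (c := ENNReal.ofReal (1 / 2)) (by simp) (by simp) ?_
          filter_upwards [hroot.eventually (lt_mem_nhds (sub_lt_self 1 hε))] with n hn
          have hindep' : IndepFun U (x n) Pr :=
            hindep.comp measurable_id (measurable_pi_apply n)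
          rw [Measure.map_apply (hxmeas n) hVopen.measurableSet,
            Measure.map_apply (hsmul n) hB, ← hUhalf,
            ← hindep'.measure_inter_preimage_eq_mul _ _ measurableSet_Icc hVopen.measurableSet]
          refine measure_mono fun ω ⟨hω, hωV⟩ => hST (hεS ?_) (hVT hωV)
          have hlower : (1 / 2 : ℝ) ^ ((n : ℝ)⁻¹) ≤ U ω ^ ((n : ℝ)⁻¹) :=
            Real.rpow_le_rpow (by norm_num) hω.1 (by positivity)
          have hupper : U ω ^ ((n : ℝ)⁻¹) ≤ 1 :=
            Real.rpow_le_one (le_trans (by norm_num) hω.1) hω.2 (by positivity)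
          rw [Real.dist_eq, abs_lt]
          constructor <;> linarith
  · set G := {y : EuclideanSpace ℝ (Fin m) | ∃ t ∈ Set.Icc (0 : ℝ) 1, t • y ∈ closure B} with hG
    have hGclosed : IsClosed G := isClosed_setOf_exists_smul_mem isClosed_closure
    calc _ ≤ limsup (ldScale (fun n => Measure.map (x n) Pr) G) atTop := by
          refine limsup_le_limsup (Eventually.of_forall fun n => ldScale_mono ?_)
          rw [Measure.map_apply (hxmeas n) hGclosed.measurableSet,
            Measure.map_apply (hsmul n) hB]
          refine measure_mono_ae ?_
          filter_upwards [hUmem] with ω hω hωB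
          exact ⟨_, ⟨Real.rpow_nonneg hω.1 _, Real.rpow_le_one hω.1 hω.2 (by positivity)⟩,
            subset_closure hωB⟩
      _ ≤ -(⨅ z ∈ closure G, I z) := (hLDP.2 G hGclosed.measurableSet).2
      _ ≤ -(⨅ z ∈ closure B, I z) := by
          rw [EReal.neg_le_neg_iff, hGclosed.closure_eq]
          refine le_iInf₂ fun y ⟨t, ht, hty⟩ => (iInf₂_le _ hty).trans ?_
          simpa using hmono y t 1 ht.1 ht.2


end
end

section
/- Fix k ∈ ℕ and let η be a real symmetric k×k matrix. Then sup{ tr(ζη) : ζ a real symmetric k×k matrix with (1/2) I_k − ζ positive definite } equals (1/2) tr(η) if η is positive semidefinite, and equals +∞ otherwise. -/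
open Matrix
open scoped ENNReal Classical

noncomputable section

open scoped MatrixOrder in
/-- The trace of the product of two positive semidefinite real matrices is nonnegative. -/
theorem Matrix.PosSemidef.trace_mul_nonneg {n : Type*} [Fintype n] {A B : Matrix n n ℝ}
    (hA : A.PosSemidef) (hB : B.PosSemidef) : 0 ≤ (A * B).trace := by
  obtain ⟨C, rfl⟩ := CStarAlgebra.nonneg_iff_eq_star_mul_self.mp hB.nonneg
  rw [Matrix.star_eq_conjTranspose, ← Matrix.mul_assoc, Matrix.trace_mul_comm, ← Matrix.mul_assoc]
  exact (hA.mul_mul_conjTranspose_same C).trace_nonneg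

/-- A symmetric real matrix which is not positive semidefinite has a negative direction. -/
theorem Matrix.IsSymm.exists_dotProduct_mulVec_neg {n : Type*} [Fintype n] {A : Matrix n n ℝ}
    (hA : A.IsSymm) (h : ¬A.PosSemidef) : ∃ x : n → ℝ, x ⬝ᵥ A *ᵥ x < 0 := by
  contrapose! h
  refine Matrix.PosSemidef.of_dotProduct_mulVec_nonneg ?_ fun x => by simpa using h x
  rwa [Matrix.IsHermitian, Matrix.conjTranspose_eq_transpose_of_trivial]

/-- **Supremum of the trace pairing over the shifted positive-definite cone.**
Fix `k ∈ ℕ` and let `η` be a real symmetric `k × k` matrix.  Then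
`sup { tr(ζ η) : ζ symmetric, (1/2) I_k − ζ positive definite }` equals `(1/2) tr η`
if `η` is positive semidefinite, and equals `+∞` otherwise. -/
theorem sup_trace_pairing_shifted_cone
    (k : ℕ) (η : Matrix (Fin k) (Fin k) ℝ) (hη : η.IsSymm) :
    (⨆ ζ : {ζ : Matrix (Fin k) (Fin k) ℝ //
        ζ.IsSymm ∧ ((2 : ℝ)⁻¹ • (1 : Matrix (Fin k) (Fin k) ℝ) - ζ).PosDef},
      ((Matrix.trace (ζ.1 * η) : ℝ) : EReal)) =
      if η.PosSemidef then (((2 : ℝ)⁻¹ * Matrix.trace η : ℝ) : EReal) else (⊤ : EReal) := by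
  split_ifs with h
  · refine le_antisymm (iSup_le fun ζ => ?_) ?_
    · rw [EReal.coe_le_coe_iff]
      have := ζ.2.2.posSemidef.trace_mul_nonneg h
      simpa [Matrix.sub_mul] using this
    · have hlim : Filter.Tendsto
          (fun n : ℕ => (((2 : ℝ)⁻¹ - 1 / ((n : ℝ) + 1)) * η.trace : ℝ)) Filter.atTop
          (nhds ((2 : ℝ)⁻¹ * η.trace)) := by
        simpa using (tendsto_one_div_add_atTop_nhds_zero_nat.const_sub (2 : ℝ)⁻¹).mul_const η.trace
      refine le_of_tendsto' ((continuous_coe_real_ereal.tendsto _).comp hlim) fun n => ?_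
      refine le_iSup_of_le
        ⟨((2 : ℝ)⁻¹ - 1 / ((n : ℝ) + 1)) • (1 : Matrix (Fin k) (Fin k) ℝ),
          Matrix.isSymm_one.smul _, ?_⟩ ?_
      · rw [← sub_smul, sub_sub_cancel]
        exact Matrix.PosDef.one.smul (by positivity)
      · simp
  · obtain ⟨x, hx⟩ := hη.exists_dotProduct_mulVec_neg h
    rw [EReal.eq_top_iff_forall_lt]
    intro c
    obtain ⟨n, hn⟩ := exists_nat_gt (c / -(x ⬝ᵥ η *ᵥ x))
    rw [div_lt_iff₀ (neg_pos.mpr hx)] at hn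
    refine lt_of_lt_of_le (EReal.coe_lt_coe_iff.mpr hn) (le_iSup_of_le
      ⟨-((n : ℝ) • Matrix.vecMulVec x x), ?_, ?_⟩ ?_)
    · simp [Matrix.IsSymm, Matrix.transpose_vecMulVec]
    · rw [sub_neg_eq_add]
      refine (Matrix.PosDef.one.smul (by positivity)).add_posSemidef (.smul ?_ (by positivity))
      simpa using Matrix.posSemidef_vecMulVec_self_star x
    · rw [EReal.coe_le_coe_iff]
      simp [Matrix.vecMulVec_mul, Matrix.trace_vecMulVec, Matrix.dotProduct_mulVec,
        dotProduct_comm]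

end
end
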